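/- Fundamental theorem of arithmetic for lucky numbers: every positive integer n ≥ 1 can be written as n = a₁*(a₂*(a₃*(⋯*a_k)⋯)) for a unique length k ≥ 1 and a unique finite tuple (a₁, …, a_k) such that a_j ∈ 𝕃 for all j < k and a_k is a lucky number (possibly 1); for k = 1 the representation reads n = a₁ with a₁ lucky. -/

import Mathlib

open scoped BigOperators

namespace LuckyPaper

/-- Rank of `k` in `A`: the number of elements of `A` that are `≤ k`
(the 1-indexed position of `k` in `A` when `k ∈ A`). -/
noncomputable def rank (A : Set ℕ) (k : ℕ) : ℕ := Set.ncard {m | m ∈ A ∧ m ≤ k}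

/-- One sieve step: delete every `d`-th element of `A` (listed in increasing order). -/
noncomputable def step (A : Set ℕ) (d : ℕ) : Set ℕ := {k | k ∈ A ∧ ¬ d ∣ rank A k}

/-- The lucky sieve: `sieve i = (A_i, l_i)`, where `A_0 = {1,2,3,…}`, `l_0 = 1` (dummy),
`l_{i+1}` is the smallest element of `A_i` larger than `l_i`, and `A_{i+1}` is obtained
from `A_i` by deleting every `l_{i+1}`-th element.  In particular `l_1 = 2`. -/
noncomputable def sieve : ℕ → Set ℕ × ℕ
  | 0 => ({n | 1 ≤ n}, 1)
  | i + 1 =>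
      let p := sieve i
      let d := sInf {m | m ∈ p.1 ∧ p.2 < m}
      (step p.1 d, d)

/-- `A i` : the set of survivors after `i` steps of the lucky sieve. -/
noncomputable def A (i : ℕ) : Set ℕ := (sieve i).1

/-- `l i` : the `i`-th sieve parameter (`l 1 = 2`, `l 2 = 3`, `l 3 = 7`, `l 4 = 9`, …);
with this convention `l n` is the `n`-th lucky number for `n ≥ 2`. -/
noncomputable def l (i : ℕ) : ℕ := (sieve i).2

/-- The set of lucky numbers `A_∞ = ⋂ i, A i = {1, 3, 7, 9, 13, 15, 21, 25, …}`. -/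
noncomputable def LuckySet : Set ℕ := ⋂ i, A i

/-- `L x` : the number of lucky numbers that are `≤ x`. -/
noncomputable def L (x : ℝ) : ℕ := Set.ncard {m | m ∈ LuckySet ∧ (m : ℝ) ≤ x}

/-- `R i x = #{k ∈ A_{i-1} : k ≤ x}`. -/
noncomputable def R (i : ℕ) (x : ℝ) : ℕ := Set.ncard {m | m ∈ A (i - 1) ∧ (m : ℝ) ≤ x}

/-- `𝕃 = {l 1, l 2, l 3, …} = {2, 3, 7, 9, 13, …}`. -/
noncomputable def Ell : Set ℕ := {a | ∃ i, 1 ≤ i ∧ l i = a}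

/-- `starIdx i m` : the `m`-th number deleted at step `i` of the sieve, i.e. the
`(l i * m)`-th smallest element of `A (i-1)` (`Nat.nth` is 0-indexed). -/
noncomputable def starIdx (i m : ℕ) : ℕ := Nat.nth (· ∈ A (i - 1)) (l i * m - 1)

/-- The binary operation `*` : for `a ∈ 𝕃`, `star a m = a * m` is the `m`-th number
deleted at the (unique) step `i ≥ 1` with `l i = a`. -/
noncomputable def star (a m : ℕ) : ℕ := starIdx (sInf {i | 1 ≤ i ∧ l i = a}) m

/-- `evalStar [a₁, …, a_k] = a₁ * (a₂ * (⋯ * a_k)⋯)`. -/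
noncomputable def evalStar : List ℕ → ℕ
  | [] => 1
  | [a] => a
  | a :: b :: rest => star a (evalStar (b :: rest))

/-- `t = (a₁, …, a_k)` is a lucky factorization of `n` : `k ≥ 1`, `a_j ∈ 𝕃` for `j < k`,
`a_k` is a lucky number (possibly 1), and `n = a₁*(a₂*(⋯*a_k)⋯)`. -/
def IsLuckyFactorization (n : ℕ) (t : List ℕ) : Prop :=
  t ≠ [] ∧ (∀ a ∈ t.dropLast, a ∈ Ell) ∧ t.getLast! ∈ LuckySet ∧ evalStar t = n

/-- The canonical tuple of `n` given by the fundamental theorem of arithmetic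
for lucky numbers. -/
noncomputable def canonicalTuple (n : ℕ) : List ℕ :=
  haveI := Classical.propDecidable (∃ t, IsLuckyFactorization n t)
  if h : ∃ t, IsLuckyFactorization n t then h.choose else []

/-- `Ω°(n)` : the length of the canonical tuple of `n`. -/
noncomputable def bigOmega (n : ℕ) : ℕ := (canonicalTuple n).length

/-- `ω°(n)` : the number of distinct entries of the canonical tuple of `n`. -/
noncomputable def smallOmega (n : ℕ) : ℕ := (canonicalTuple n).dedup.length

/-- `d°(n)` : the number of distinct nonempty contiguous subtuples (infixes) of the
canonical tuple of `n`. -/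
noncomputable def dCirc (n : ℕ) : ℕ :=
  Set.ncard {s : List ℕ | s ≠ [] ∧ s <:+: canonicalTuple n}

/-- `B` : positive integers whose canonical tuple has last entry `≠ 1`. -/
noncomputable def Bset : Set ℕ := {n | 1 ≤ n ∧ (canonicalTuple n).getLast! ≠ 1}

/-- `C` : positive integers whose canonical tuple ends with the pair `(2, 1)`. -/
noncomputable def Cset : Set ℕ := {n | 1 ≤ n ∧ ∃ t, canonicalTuple n = t ++ [2, 1]}

/-- `S = B ∪ C`. -/
noncomputable def Sset : Set ℕ := Bset ∪ Cset

/-- The `𝕃`-tuple of `a ∈ S` : the canonical tuple of `a` if it does not end in `1`,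
else the canonical tuple with the final `1` removed (so it ends in `2`). -/
noncomputable def ellTuple (a : ℕ) : List ℕ :=
  if (canonicalTuple a).getLast! = 1 then (canonicalTuple a).dropLast else canonicalTuple a

/-- The extended operation `∘` : if the `𝕃`-tuple of `a` is `(t₁, …, t_k)`, then
`a ∘ b = t₁*(t₂*(⋯*(t_k*b)⋯))`. -/
noncomputable def circ (a b : ℕ) : ℕ := (ellTuple a).foldr star b


open scoped Classical in
theorem rank_eq_count_succ (S : Set ℕ) (k : ℕ) : rank S k = Nat.count (· ∈ S) (k + 1) := by
  rw [Nat.count_eq_card_filter_range, rank, ← Set.ncard_coe_finset]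
  congr 1
  ext m
  simp [and_comm]

theorem rank_le_self {S : Set ℕ} (h0 : 0 ∉ S) (k : ℕ) : rank S k ≤ k := by
  classical
  rw [rank_eq_count_succ, Nat.count_succ']
  simpa [h0] using Nat.count_le (fun k => k + 1 ∈ S)

theorem rank_pos {S : Set ℕ} {k : ℕ} (hk : k ∈ S) : 0 < rank S k := by
  classical
  simp [rank_eq_count_succ, Nat.count_succ, hk]

theorem nth_rank_sub_one {S : Set ℕ} {k : ℕ} (hk : k ∈ S) :
    Nat.nth (· ∈ S) (rank S k - 1) = k := by
  classical
  simp [rank_eq_count_succ, Nat.count_succ, hk]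

theorem rank_nth {S : Set ℕ} (hS : S.Infinite) (j : ℕ) :
    rank S (Nat.nth (· ∈ S) j) = j + 1 := by
  classical
  rw [rank_eq_count_succ]
  exact Nat.count_nth_succ_of_infinite (p := (· ∈ S)) hS j

theorem step_infinite {S : Set ℕ} (hS : S.Infinite) {d : ℕ} (hd : 2 ≤ d) :
    (step S d).Infinite := by
  refine Set.infinite_of_injective_forall_mem (f := fun j => Nat.nth (· ∈ S) (d * j)) ?_ ?_
  · exact (Nat.nth_injective hS).comp (mul_right_injective₀ (by omega))
  · intro j
    refine ⟨Nat.nth_mem_of_infinite hS _, ?_⟩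
    rw [rank_nth hS, Nat.dvd_add_right (Nat.dvd_mul_right d j), Nat.dvd_one]
    omega

theorem A_succ (i : ℕ) : A (i + 1) = step (A i) (l (i + 1)) := rfl

theorem l_lt_succ_of_infinite {i : ℕ} (h : (A i).Infinite) : l i < l (i + 1) := by
  obtain ⟨m, hm, hlt⟩ := h.exists_gt (l i)
  exact (Nat.sInf_mem (s := {m | m ∈ A i ∧ l i < m}) ⟨m, hm, hlt⟩).2

theorem A_infinite_and_l_pos (i : ℕ) : (A i).Infinite ∧ 1 ≤ l i := by
  induction i with
  | zero => exact ⟨Set.Ici_infinite 1, le_rfl⟩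
  | succ i ih =>
    have hlt := l_lt_succ_of_infinite ih.1
    exact ⟨step_infinite ih.1 (show 2 ≤ l (i + 1) by omega), by omega⟩

theorem A_infinite (i : ℕ) : (A i).Infinite := (A_infinite_and_l_pos i).1

theorem l_strictMono : StrictMono l :=
  strictMono_nat_of_lt_succ fun i => l_lt_succ_of_infinite (A_infinite i)

theorem two_le_l_succ (i : ℕ) : 2 ≤ l (i + 1) := by
  have := (A_infinite_and_l_pos i).2
  have := l_strictMono (Nat.lt_add_one i)
  omega

theorem A_antitone : Antitone A := antitone_nat_of_succ_le fun _ _ h => h.1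

theorem one_le_of_mem_A {i n : ℕ} (h : n ∈ A i) : 1 ≤ n := A_antitone i.zero_le h

theorem star_l_succ (i m : ℕ) :
    star (l (i + 1)) m = Nat.nth (· ∈ A i) (l (i + 1) * m - 1) := by
  have h : {j | 1 ≤ j ∧ l j = l (i + 1)} = {i + 1} := by
    ext j
    simp only [Set.mem_ofPred_eq, Set.mem_singleton_iff, l_strictMono.injective.eq_iff]
    omega
  rw [star, h, csInf_singleton, starIdx, Nat.add_sub_cancel]

theorem star_mem_A (i m : ℕ) : star (l (i + 1)) m ∈ A i := by
  rw [star_l_succ]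
  exact Nat.nth_mem_of_infinite (A_infinite i) _

theorem rank_star (i : ℕ) {m : ℕ} (hm : 1 ≤ m) :
    rank (A i) (star (l (i + 1)) m) = l (i + 1) * m := by
  have : 0 < l (i + 1) * m := Nat.mul_pos (by linarith [two_le_l_succ i]) hm
  rw [star_l_succ, rank_nth (A_infinite i)]
  omega

theorem star_notMem_A_succ (i : ℕ) {m : ℕ} (hm : 1 ≤ m) : star (l (i + 1)) m ∉ A (i + 1) :=
  fun h => h.2 (rank_star i hm ▸ Nat.dvd_mul_right _ _)

theorem star_notMem_LuckySet {a m : ℕ} (ha : a ∈ Ell) (hm : 1 ≤ m) : star a m ∉ LuckySet := by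
  obtain ⟨i, hi, rfl⟩ := ha
  obtain ⟨i, rfl⟩ := Nat.exists_eq_add_of_le' hi
  exact fun h => star_notMem_A_succ i hm (Set.mem_iInter.1 h _)

theorem one_le_star {a : ℕ} (ha : a ∈ Ell) (m : ℕ) : 1 ≤ star a m := by
  obtain ⟨i, hi, rfl⟩ := ha
  obtain ⟨i, rfl⟩ := Nat.exists_eq_add_of_le' hi
  exact one_le_of_mem_A (star_mem_A i m)

theorem star_inj {a b m m' : ℕ} (ha : a ∈ Ell) (hb : b ∈ Ell) (hm : 1 ≤ m) (hm' : 1 ≤ m')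
    (h : star a m = star b m') : a = b ∧ m = m' := by
  obtain ⟨i, hi, rfl⟩ := ha
  obtain ⟨i, rfl⟩ := Nat.exists_eq_add_of_le' hi
  obtain ⟨j, hj, rfl⟩ := hb
  obtain ⟨j, rfl⟩ := Nat.exists_eq_add_of_le' hj
  have hij : i = j := by
    rcases lt_trichotomy i j with hlt | rfl | hlt
    · exact (star_notMem_A_succ i hm (h ▸ A_antitone hlt (star_mem_A j m'))).elim
    · rfl
    · exact (star_notMem_A_succ j hm' (h ▸ A_antitone hlt (star_mem_A i m))).elim
  subst hij
  have hr := congrArg (rank (A i)) h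
  rw [rank_star i hm, rank_star i hm'] at hr
  exact ⟨rfl, Nat.eq_of_mul_eq_mul_left (by linarith [two_le_l_succ i]) hr⟩

theorem exists_star_eq {n : ℕ} (hn : 1 ≤ n) (h : n ∉ LuckySet) :
    ∃ a ∈ Ell, ∃ m, 1 ≤ m ∧ m < n ∧ star a m = n := by
  have hex : ∃ i, n ∉ A i := by simpa [LuckySet] using h
  obtain ⟨i, hi, hi'⟩ : ∃ i, n ∈ A i ∧ n ∉ A (i + 1) := by
    by_contra! hc
    obtain ⟨i, hi⟩ := hex
    exact hi (Nat.rec hn hc i)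
  have hdvd : l (i + 1) ∣ rank (A i) n := by
    by_contra hd
    exact hi' ⟨hi, hd⟩
  obtain ⟨m, hm⟩ := hdvd
  have hpos := rank_pos hi
  have hle := rank_le_self (fun h0 => absurd (one_le_of_mem_A h0) (by omega)) n (S := A i)
  have hm1 : 1 ≤ m := Nat.pos_of_ne_zero (by rintro rfl; omega)
  refine ⟨_, ⟨i + 1, by omega, rfl⟩, m, hm1, ?_, ?_⟩
  · nlinarith [two_le_l_succ i]
  · rw [star_l_succ, ← hm, nth_rank_sub_one hi]

theorem isLuckyFactorization_singleton {n a : ℕ} :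
    IsLuckyFactorization n [a] ↔ a ∈ LuckySet ∧ a = n := by
  simp [IsLuckyFactorization, evalStar]

theorem isLuckyFactorization_cons_cons {n a b : ℕ} {t : List ℕ} :
    IsLuckyFactorization n (a :: b :: t) ↔
      a ∈ Ell ∧ ∃ m, IsLuckyFactorization m (b :: t) ∧ star a m = n := by
  simp [IsLuckyFactorization, evalStar, List.getLast!_eq_getLast?_getD, and_assoc]

theorem IsLuckyFactorization.one_le {n : ℕ} {t : List ℕ} (h : IsLuckyFactorization n t) :
    1 ≤ n := by
  match t with
  | [] => exact absurd rfl h.1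
  | [a] =>
    obtain ⟨ha, rfl⟩ := isLuckyFactorization_singleton.1 h
    exact one_le_of_mem_A (Set.mem_iInter.1 ha 0)
  | a :: b :: t =>
    obtain ⟨ha, m, -, rfl⟩ := isLuckyFactorization_cons_cons.1 h
    exact one_le_star ha m

theorem IsLuckyFactorization.unique {n : ℕ} {t s : List ℕ} (ht : IsLuckyFactorization n t)
    (hs : IsLuckyFactorization n s) : t = s := by
  induction t generalizing n s with
  | nil => exact absurd rfl ht.1
  | cons a t ih =>
    match t, s with
    | _, [] => exact absurd rfl hs.1
    | [], [c] =>
      obtain ⟨-, rfl⟩ := isLuckyFactorization_singleton.1 ht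
      obtain ⟨-, rfl⟩ := isLuckyFactorization_singleton.1 hs
      rfl
    | [], c :: d :: s =>
      obtain ⟨ha, rfl⟩ := isLuckyFactorization_singleton.1 ht
      obtain ⟨hc, m, hm, rfl⟩ := isLuckyFactorization_cons_cons.1 hs
      exact absurd ha (star_notMem_LuckySet hc hm.one_le)
    | b :: t, [c] =>
      obtain ⟨hc, rfl⟩ := isLuckyFactorization_singleton.1 hs
      obtain ⟨ha, m, hm, rfl⟩ := isLuckyFactorization_cons_cons.1 ht
      exact absurd hc (star_notMem_LuckySet ha hm.one_le)
    | b :: t, c :: d :: s =>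
      obtain ⟨ha, m, hm, rfl⟩ := isLuckyFactorization_cons_cons.1 ht
      obtain ⟨hc, m', hm', h⟩ := isLuckyFactorization_cons_cons.1 hs
      obtain ⟨rfl, rfl⟩ := star_inj hc ha hm'.one_le hm.one_le h
      rw [ih hm hm']

theorem exists_isLuckyFactorization {n : ℕ} (hn : 1 ≤ n) : ∃ t, IsLuckyFactorization n t := by
  induction n using Nat.strong_induction_on with
  | _ n ih =>
    by_cases h : n ∈ LuckySet
    · exact ⟨[n], isLuckyFactorization_singleton.2 ⟨h, rfl⟩⟩
    · obtain ⟨a, ha, m, hm, hlt, rfl⟩ := exists_star_eq hn h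
      obtain ⟨t, ht⟩ := ih m hlt hm
      obtain ⟨b, t, rfl⟩ := List.exists_cons_of_ne_nil ht.1
      exact ⟨a :: b :: t, isLuckyFactorization_cons_cons.2 ⟨ha, m, ht, rfl⟩⟩

/-- fundamental theorem of arithmetic for lucky numbers: every positive
integer `n ≥ 1` can be written as `n = a₁*(a₂*(a₃*(⋯*a_k)⋯))` for a unique length
`k ≥ 1` and a unique finite tuple `(a₁, …, a_k)` with `a_j ∈ 𝕃` for all `j < k` and
`a_k` a lucky number (possibly 1). -/
theorem lucky_factorization_exists_unique (n : ℕ) (hn : 1 ≤ n) :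
    ∃! t : List ℕ, IsLuckyFactorization n t := by
  obtain ⟨t, ht⟩ := exists_isLuckyFactorization hn
  exact ⟨t, ht, fun _ hs => hs.unique ht⟩

end LuckyPaper
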